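/- arXiv:2502.02410 — 3 statements merged into one kernel-verified Lean document; each statement's English description precedes it below -/
import Mathlib

section
/- Let n ∈ ℕ, σ > 0, and 0 ≤ q ≤ p ≤ 1. For s ∈ [0,1] define the Gaussian mixtures P_s = Σ_{k=0}^{n} Binom(k; n, s)·N(−k, σ) and Q_s = Σ_{k=0}^{n} Binom(k; n, s)·N(k, σ) on ℝ. Then for every α ≥ 0: H_α(P_q ‖ Q_q) ≤ H_α(P_p ‖ Q_p). -/
open MeasureTheory ProbabilityTheory ENNReal

noncomputable section

/-- Hockey-stick divergence `H_α(P‖Q) = sup_A (P(A) − α·Q(A))`. -/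
def hsDiv {Ω : Type*} [MeasurableSpace Ω] (α : ℝ) (P Q : Measure Ω) : ℝ :=
  ⨆ A : {s : Set Ω // MeasurableSet s}, ((P A.1).toReal - α * (Q A.1).toReal)

/-- Gaussian on ℝ with mean μ and standard deviation σ. -/
def gauss1 (μ σ : ℝ) : Measure ℝ := gaussianReal μ ⟨σ ^ 2, sq_nonneg σ⟩

/-- Binomial probability `Binom(k; n, q)`. -/
def binomR (n : ℕ) (q : ℝ) (k : ℕ) : ℝ := (n.choose k : ℝ) * q ^ k * (1 - q) ^ (n - k)

/-- `P_s = Σ_{k=0}^{n} Binom(k; n, s)·N(−k, σ)`. -/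
def mixNeg (n : ℕ) (s σ : ℝ) : Measure ℝ :=
  ∑ k : Fin (n + 1), ENNReal.ofReal (binomR n s (k : ℕ)) • gauss1 (-(k : ℕ)) σ

/-- `Q_s = Σ_{k=0}^{n} Binom(k; n, s)·N(k, σ)`. -/
def mixPos (n : ℕ) (s σ : ℝ) : Measure ℝ :=
  ∑ k : Fin (n + 1), ENNReal.ofReal (binomR n s (k : ℕ)) • gauss1 (k : ℕ) σ

lemma binomR_nonneg {n k : ℕ} {s : ℝ} (h0 : 0 ≤ s) (h1 : s ≤ 1) : 0 ≤ binomR n s k := by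
  have : 0 ≤ 1 - s := sub_nonneg.2 h1
  unfold binomR
  positivity

lemma binomR_succ_zero (n : ℕ) (s : ℝ) : binomR (n + 1) s 0 = (1 - s) * binomR n s 0 := by
  simp [binomR, pow_succ']

lemma binomR_succ_succ (n k : ℕ) (s : ℝ) :
    binomR (n + 1) s (k + 1) = (1 - s) * binomR n s (k + 1) + s * binomR n s k := by
  unfold binomR
  rcases lt_or_ge k n with h | h
  · obtain ⟨m, rfl⟩ := Nat.exists_eq_add_of_lt h
    rw [show k + m + 1 + 1 - (k + 1) = m + 1 by lia, show k + m + 1 - (k + 1) = m by lia,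
      show k + m + 1 - k = m + 1 by lia, Nat.choose_succ_succ]
    push_cast
    ring
  · rw [Nat.choose_succ_succ, Nat.choose_eq_zero_of_lt (show n < k + 1 by lia),
      Nat.add_sub_add_right]
    push_cast
    ring

lemma binomR_self_succ (n : ℕ) (s : ℝ) : binomR n s (n + 1) = 0 := by
  simp [binomR]

/-- Conditioning the binomial expectation on the first trial. -/
lemma sum_binomR_succ (n : ℕ) (s : ℝ) (g : ℕ → ℝ) :
    ∑ k ∈ Finset.range (n + 2), binomR (n + 1) s k * g k =
      (1 - s) * ∑ k ∈ Finset.range (n + 1), binomR n s k * g k +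
        s * ∑ k ∈ Finset.range (n + 1), binomR n s k * g (k + 1) := by
  have h : ∑ k ∈ Finset.range (n + 1), binomR n s k * g k =
      ∑ k ∈ Finset.range (n + 1), binomR n s (k + 1) * g (k + 1) + binomR n s 0 * g 0 := by
    rw [← Finset.sum_range_succ' (fun k ↦ binomR n s k * g k), Finset.sum_range_succ _ (n + 1), binomR_self_succ, zero_mul,
      add_zero]
  rw [Finset.sum_range_succ', h, binomR_succ_zero]
  simp only [binomR_succ_succ, add_mul, Finset.sum_add_distrib, mul_add, Finset.mul_sum, mul_assoc]
  ring

/-- Binomial laws are stochastically increasing in the success probability. -/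
lemma sum_binomR_mul_mono {p q : ℝ} (hq0 : 0 ≤ q) (hqp : q ≤ p) (hp1 : p ≤ 1) (n : ℕ) :
    ∀ {g : ℕ → ℝ}, Monotone g →
      ∑ k ∈ Finset.range (n + 1), binomR n q k * g k ≤
        ∑ k ∈ Finset.range (n + 1), binomR n p k * g k := by
  induction n with
  | zero => intro g _; simp [binomR]
  | succ n ih =>
    intro g hg
    have h₀ := ih hg
    have h₁ := ih (g := fun k ↦ g (k + 1)) fun a b hab ↦ hg (by lia)
    have h₂ : ∑ k ∈ Finset.range (n + 1), binomR n p k * g k ≤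
        ∑ k ∈ Finset.range (n + 1), binomR n p k * g (k + 1) :=
      Finset.sum_le_sum fun k _ ↦ mul_le_mul_of_nonneg_left (hg k.le_succ)
        (binomR_nonneg (hq0.trans hqp) hp1)
    rw [sum_binomR_succ, sum_binomR_succ]
    nlinarith [mul_le_mul_of_nonneg_left h₀ (sub_nonneg.2 (hqp.trans hp1)),
      mul_le_mul_of_nonneg_left h₁ hq0, mul_le_mul_of_nonneg_left h₂ (sub_nonneg.2 hqp)]

lemma gauss1_eq_gaussianReal (μ σ : ℝ) : gauss1 μ σ = gaussianReal μ (σ ^ 2).toNNReal := by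
  rw [Real.toNNReal_of_nonneg (sq_nonneg σ)]
  rfl

instance (μ σ : ℝ) : IsProbabilityMeasure (gauss1 μ σ) := by
  rw [gauss1_eq_gaussianReal]
  infer_instance

lemma gauss1_real_anti {σ : ℝ} {L : Set ℝ} (hL : IsLowerSet L) :
    Antitone fun μ ↦ (gauss1 μ σ).real L := by
  have hLm : MeasurableSet L := hL.ordConnected.measurableSet
  intro a b hab
  have h (c : ℝ) : gauss1 c σ = (gauss1 0 σ).map (· + c) := by
    simp [gauss1_eq_gaussianReal, gaussianReal_map_add_const]
  simp only [h a, h b]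
  rw [map_measureReal_apply (by fun_prop) hLm, map_measureReal_apply (by fun_prop) hLm]
  exact measureReal_mono fun x hx ↦ hL (by simpa using hab) hx

lemma toReal_sum_binomR_smul_gauss1 {n : ℕ} {s σ : ℝ} (h0 : 0 ≤ s) (h1 : s ≤ 1) (c : ℕ → ℝ)
    (A : Set ℝ) :
    ((∑ k : Fin (n + 1), ENNReal.ofReal (binomR n s (k : ℕ)) • gauss1 (c k) σ) A).toReal =
      ∑ k ∈ Finset.range (n + 1), binomR n s k * (gauss1 (c k) σ).real A := by
  rw [Measure.finsetSum_apply, ENNReal.toReal_sum (by simp [ENNReal.mul_eq_top]),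
    ← Fin.sum_univ_eq_sum_range (fun k ↦ binomR n s k * (gauss1 (c k) σ).real A)]
  simp [ENNReal.toReal_ofReal (binomR_nonneg h0 h1), measureReal_def]

lemma gauss1_real_eq_setIntegral {μ σ : ℝ} (hσ : 0 < σ) (A : Set ℝ) :
    (gauss1 μ σ).real A = ∫ x in A, gaussianPDFReal μ (σ ^ 2).toNNReal x := by
  have hv : (σ ^ 2).toNNReal ≠ 0 := by simp [hσ.ne']
  rw [measureReal_def, gauss1_eq_gaussianReal, gaussianReal_apply_eq_integral _ hv, ENNReal.toReal_ofReal]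
  exact integral_nonneg fun x ↦ gaussianPDFReal_nonneg _ _ _

lemma gaussianPDFReal_eq_mul_exp (μ : ℝ) (v : NNReal) (x : ℝ) :
    gaussianPDFReal μ v x = gaussianPDFReal 0 v x * Real.exp ((2 * μ * x - μ ^ 2) / (2 * v)) := by
  rw [gaussianPDFReal, gaussianPDFReal, mul_assoc _ (Real.exp _), ← Real.exp_add]
  ring_nf

/-- By monotonicity of the likelihood ratio, the optimal test between mixtures of left and right
shifts of a Gaussian is a lower set. -/
lemma isLowerSet_nonneg_gaussian_mixture_sub {v : NNReal} (hv : v ≠ 0) {α : ℝ} (hα : 0 ≤ α)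
    (S : Finset ℕ) {w : ℕ → ℝ} (hw : ∀ k, 0 ≤ w k) :
    IsLowerSet {x | 0 ≤ ∑ k ∈ S, w k * gaussianPDFReal (-(k : ℝ)) v x -
      α * ∑ k ∈ S, w k * gaussianPDFReal (k : ℝ) v x} := by
  have hfac (c : ℕ → ℝ) (x : ℝ) : ∑ k ∈ S, w k * gaussianPDFReal (c k) v x =
      gaussianPDFReal 0 v x *
        ∑ k ∈ S, w k * Real.exp ((2 * c k * x - c k ^ 2) / (2 * v)) := by
    rw [Finset.mul_sum]
    refine Finset.sum_congr rfl fun k _ ↦ ?_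
    rw [gaussianPDFReal_eq_mul_exp]
    ring
  intro x y hyx hx
  simp only [Set.mem_ofPred_eq, hfac (fun k ↦ -(k : ℝ)), hfac (fun k ↦ (k : ℝ)),
    mul_left_comm α, ← mul_sub, mul_nonneg_iff_of_pos_left (gaussianPDFReal_pos 0 v _ hv)] at hx ⊢
  refine hx.trans (sub_le_sub ?_ (mul_le_mul_of_nonneg_left ?_ hα))
  all_goals
    refine Finset.sum_le_sum fun k _ ↦ mul_le_mul_of_nonneg_left (Real.exp_le_exp.2 ?_) (hw k)
    gcongr ?_ / _
    nlinarith [mul_le_mul_of_nonneg_left hyx (Nat.cast_nonneg (α := ℝ) k)]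

lemma exists_isLowerSet_mix_sub_le {n : ℕ} {s σ α : ℝ} (hσ : 0 < σ) (h0 : 0 ≤ s) (h1 : s ≤ 1)
    (hα : 0 ≤ α) {A : Set ℝ} (hA : MeasurableSet A) :
    ∃ L, IsLowerSet L ∧ (mixNeg n s σ A).toReal - α * (mixPos n s σ A).toReal ≤
      (mixNeg n s σ L).toReal - α * (mixPos n s σ L).toReal := by
  set v : NNReal := (σ ^ 2).toNNReal
  have hv : v ≠ 0 := by simp [v, hσ.ne']
  set S := Finset.range (n + 1)
  set f : ℝ → ℝ := fun x ↦ ∑ k ∈ S, binomR n s k * gaussianPDFReal (-(k : ℝ)) v x -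
    α * ∑ k ∈ S, binomR n s k * gaussianPDFReal (k : ℝ) v x with hf
  have hint (c : ℕ → ℝ) : Integrable fun x ↦ ∑ k ∈ S, binomR n s k * gaussianPDFReal (c k) v x :=
    integrable_finsetSum _ fun k _ ↦ (integrable_gaussianPDFReal _ _).const_mul _
  have hmix (c : ℕ → ℝ) (B : Set ℝ) :
      ((∑ k : Fin (n + 1), ENNReal.ofReal (binomR n s (k : ℕ)) • gauss1 (c k) σ) B).toReal =
        ∫ x in B, ∑ k ∈ S, binomR n s k * gaussianPDFReal (c k) v x := by
    rw [toReal_sum_binomR_smul_gauss1 h0 h1, integral_finsetSum _ fun k _ ↦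
      ((integrable_gaussianPDFReal _ _).const_mul _).integrableOn]
    simp only [integral_const_mul, gauss1_real_eq_setIntegral hσ, v, S]
  have key (B : Set ℝ) : (mixNeg n s σ B).toReal - α * (mixPos n s σ B).toReal =
      ∫ x in B, f x := by
    rw [integral_sub (hint fun k ↦ -(k : ℝ)).integrableOn
      ((hint fun k ↦ (k : ℝ)).const_mul α).integrableOn, integral_const_mul, ← hmix, ← hmix]
    rfl
  refine ⟨{x | 0 ≤ f x}, isLowerSet_nonneg_gaussian_mixture_sub hv hα S
    fun k ↦ binomR_nonneg h0 h1, ?_⟩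
  rw [key, key]
  refine setIntegral_le_nonneg hA (Measurable.stronglyMeasurable ?_)
    ((hint fun k ↦ -(k : ℝ)).sub ((hint fun k ↦ (k : ℝ)).const_mul α))
  fun_prop

lemma mix_sub_le_mix_sub {n : ℕ} {p q σ α : ℝ} (hq0 : 0 ≤ q) (hqp : q ≤ p) (hp1 : p ≤ 1)
    (hα : 0 ≤ α) {L : Set ℝ} (hL : IsLowerSet L) :
    (mixNeg n q σ L).toReal - α * (mixPos n q σ L).toReal ≤
      (mixNeg n p σ L).toReal - α * (mixPos n p σ L).toReal := by
  have hneg (s : ℝ) (h0 : 0 ≤ s) (h1 : s ≤ 1) := toReal_sum_binomR_smul_gauss1 (n := n) (σ := σ)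
    h0 h1 (fun k ↦ -(k : ℝ)) L
  have hpos (s : ℝ) (h0 : 0 ≤ s) (h1 : s ≤ 1) := toReal_sum_binomR_smul_gauss1 (n := n) (σ := σ)
    h0 h1 (fun k ↦ (k : ℝ)) L
  have hanti := gauss1_real_anti (σ := σ) hL
  unfold mixNeg mixPos
  rw [hneg q hq0 (hqp.trans hp1), hpos q hq0 (hqp.trans hp1), hneg p (hq0.trans hqp) hp1,
    hpos p (hq0.trans hqp) hp1]
  refine sub_le_sub (sum_binomR_mul_mono hq0 hqp hp1 n fun a b hab ↦ hanti (by simpa using hab))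
    (mul_le_mul_of_nonneg_left ?_ hα)
  have := sum_binomR_mul_mono hq0 hqp hp1 n (g := fun k ↦ -(gauss1 (k : ℝ) σ).real L)
    fun a b hab ↦ neg_le_neg (hanti (by simpa using hab))
  simpa using this

lemma bddAbove_range_hsDiv {Ω : Type*} [MeasurableSpace Ω] {α : ℝ} (hα : 0 ≤ α) (P Q : Measure Ω)
    [IsFiniteMeasure P] : BddAbove (Set.range fun A : {s : Set Ω // MeasurableSet s} ↦
      (P A.1).toReal - α * (Q A.1).toReal) := by
  refine ⟨P.real Set.univ, ?_⟩
  rintro _ ⟨A, rfl⟩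
  have h : (P A.1).toReal ≤ P.real Set.univ := measureReal_mono (Set.subset_univ _)
  have : 0 ≤ α * (Q A.1).toReal := by positivity
  linarith

instance (n : ℕ) (s σ : ℝ) : IsFiniteMeasure (mixNeg n s σ) := by
  have (c μ : ℝ) : IsFiniteMeasure (ENNReal.ofReal c • gauss1 μ σ) :=
    Measure.smul_finite _ ENNReal.ofReal_ne_top
  unfold mixNeg
  infer_instance

/-- monotonicity of the hockey-stick divergence between the
binomially-weighted Gaussian mixtures in the binomial parameter:
if `0 ≤ q ≤ p ≤ 1` then `H_α(P_q‖Q_q) ≤ H_α(P_p‖Q_p)` for all `α ≥ 0`. -/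
theorem stmt_4 (n : ℕ) (σ : ℝ) (hσ : 0 < σ) (p q : ℝ)
    (hq0 : 0 ≤ q) (hqp : q ≤ p) (hp1 : p ≤ 1) (α : ℝ) (hα : 0 ≤ α) :
    hsDiv α (mixNeg n q σ) (mixPos n q σ) ≤ hsDiv α (mixNeg n p σ) (mixPos n p σ) := by
  have : Nonempty {s : Set ℝ // MeasurableSet s} := ⟨⟨∅, MeasurableSet.empty⟩⟩
  refine ciSup_le fun A ↦ ?_
  obtain ⟨L, hL, hAL⟩ := exists_isLowerSet_mix_sub_le (n := n) hσ hq0 (hqp.trans hp1) hα A.2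
  exact (hAL.trans (mix_sub_le_mix_sub hq0 hqp hp1 hα hL)).trans
    (le_ciSup (bddAbove_range_hsDiv hα _ _) ⟨L, hL.ordConnected.measurableSet⟩)

end
end

section
/- Let A be a measurable space, let K, N', D ≥ 1 be integers, and set N = K·N'. For each k = 1,…,K let M^{(k)} be a Markov kernel from A^{N'} × ℝ^D to ℝ^D, and suppose there exist probability measures P^{(k)}, Q^{(k)} on ℝ such that for every auxiliary input z ∈ ℝ^D, every pair y, y' ∈ A^{N'} differing in exactly one index, and every α ≥ 0: H_α(M^{(k)}(y, z) ‖ M^{(k)}(y', z)) ≤ H_α(P^{(k)} ‖ Q^{(k)}). Fix o_0 ∈ ℝ^D and define the composed mechanism M : A^N → (probability measures on ℝ^D) by letting M_x be the law of o_K, where sequentially o_k ~ M^{(k)}((x_{(k−1)N'+1}, …, x_{kN'}), o_{k−1}) for k = 1,…,K. Then for every pair x, x' ∈ A^N differing in exactly one index and every α ≥ 0: H_α(M_x ‖ M_{x'}) ≤ max_{1 ≤ k ≤ K} H_α(P^{(k)} ‖ Q^{(k)}). -/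
open MeasureTheory ProbabilityTheory ENNReal

noncomputable section

/-- The `k`-th size-`N'` block of a dataset `x : Fin (K * N') → A`. -/
def blockOf {A : Type*} {K N' : ℕ} (x : Fin (K * N') → A) (k : Fin K)
    (i : Fin N') : A :=
  x ⟨(k : ℕ) * N' + (i : ℕ), by
    calc (k : ℕ) * N' + (i : ℕ) < (k : ℕ) * N' + N' := by omega
      _ = ((k : ℕ) + 1) * N' := by ring
      _ ≤ K * N' := Nat.mul_le_mul_right _ k.isLt⟩

/-- Law of the adaptively composed mechanism after `k` steps: starting from
the Dirac mass at `o₀`, the `k`-th component kernel is applied to the `k`-th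
disjoint block of the dataset together with the previous output. -/
def composedLaw {A : Type*} [MeasurableSpace A] {K N' D : ℕ}
    (M : Fin K → Kernel ((Fin N' → A) × (Fin D → ℝ)) (Fin D → ℝ))
    (x : Fin (K * N') → A) (o0 : Fin D → ℝ) : ℕ → Measure (Fin D → ℝ)
  | 0 => Measure.dirac o0
  | (k + 1) =>
      if h : k < K then
        (composedLaw M x o0 k).bind
          (fun o => M ⟨k, h⟩ (blockOf x ⟨k, h⟩, o))
      else composedLaw M x o0 k

theorem measureReal_sub_le_hsDiv {Ω : Type*} [MeasurableSpace Ω] {α : ℝ} (hα : 0 ≤ α)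
    (μ ν : Measure Ω) [IsFiniteMeasure μ] {s : Set Ω} (hs : MeasurableSet s) :
    μ.real s - α * ν.real s ≤ hsDiv α μ ν := by
  refine le_ciSup (f := fun A : {s : Set Ω // MeasurableSet s} =>
    (μ A.1).toReal - α * (ν A.1).toReal) ⟨μ.real Set.univ, ?_⟩ ⟨s, hs⟩
  rintro _ ⟨A, rfl⟩
  have h₁ : μ.real A.1 ≤ μ.real Set.univ := measureReal_mono (Set.subset_univ _)
  have h₂ : 0 ≤ α * ν.real A.1 := by positivity
  simp only [measureReal_def] at *
  linarith

theorem hsDiv_le {Ω : Type*} [MeasurableSpace Ω] {α c : ℝ} {μ ν : Measure Ω}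
    (h : ∀ s, MeasurableSet s → μ.real s - α * ν.real s ≤ c) : hsDiv α μ ν ≤ c :=
  haveI : Nonempty {s : Set Ω // MeasurableSet s} := ⟨⟨∅, MeasurableSet.empty⟩⟩
  ciSup_le fun A => h A.1 A.2

theorem integral_sub_le_hsDiv {Ω : Type*} [MeasurableSpace Ω] {α : ℝ} (hα : 0 ≤ α)
    (μ ν : Measure Ω) [IsFiniteMeasure μ] [IsFiniteMeasure ν] {f : Ω → ℝ}
    (hf : Measurable f) (hf0 : ∀ a, 0 ≤ f a) (hf1 : ∀ a, f a ≤ 1) :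
    ∫ a, f a ∂μ - α * ∫ a, f a ∂ν ≤ hsDiv α μ ν := by
  have layer : ∀ (ρ : Measure Ω) [IsFiniteMeasure ρ],
      ∫ a, f a ∂ρ = ∫ t in Set.Ioc 0 1, ρ.real {a | t ≤ f a} := fun ρ _ =>
    (Integrable.of_bound hf.aestronglyMeasurable 1 (ae_of_all _ fun a => by
      rw [Real.norm_eq_abs, abs_of_nonneg (hf0 a)]; exact hf1 a)
      : Integrable f ρ).integral_eq_integral_Ioc_meas_le
      (ae_of_all _ hf0) (ae_of_all _ hf1)
  have int : ∀ (ρ : Measure Ω) [IsFiniteMeasure ρ],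
      IntegrableOn (fun t : ℝ => ρ.real {a | t ≤ f a}) (Set.Ioc 0 1) := fun ρ _ => by
    have anti : Antitone fun t : ℝ => ρ.real {a | t ≤ f a} := fun s t hst =>
      measureReal_mono fun a (ha : t ≤ f a) => hst.trans ha
    exact ((anti.antitoneOn _).integrableOn_isCompact isCompact_Icc).mono_set
      Set.Ioc_subset_Icc_self
  rw [layer μ, layer ν, ← integral_const_mul, ← integral_sub (int μ) ((int ν).const_mul α)]
  calc _ ≤ ∫ _ in Set.Ioc (0 : ℝ) 1, hsDiv α μ ν :=
        integral_mono ((int μ).sub ((int ν).const_mul α)) (integrable_const _) fun t =>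
          measureReal_sub_le_hsDiv hα μ ν (hf measurableSet_Ici)
    _ = hsDiv α μ ν := by simp

theorem ProbabilityTheory.Kernel.integrable_measureReal {Ω Ω' : Type*} [MeasurableSpace Ω]
    [MeasurableSpace Ω'] (μ : Measure Ω) [IsFiniteMeasure μ] (κ : Kernel Ω Ω') [IsMarkovKernel κ]
    {s : Set Ω'} (hs : MeasurableSet s) : Integrable (fun a => (κ a).real s) μ :=
  Integrable.of_bound (κ.measurable_coe hs).ennreal_toReal.aestronglyMeasurable 1
    (ae_of_all _ fun a => by
      rw [Real.norm_eq_abs, abs_of_nonneg measureReal_nonneg]; exact measureReal_le_one)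

theorem MeasureTheory.Measure.measureReal_bind_kernel {Ω Ω' : Type*} [MeasurableSpace Ω]
    [MeasurableSpace Ω'] (μ : Measure Ω) (κ : Kernel Ω Ω') [IsMarkovKernel κ]
    {s : Set Ω'} (hs : MeasurableSet s) :
    (μ.bind κ).real s = ∫ a, (κ a).real s ∂μ := by
  rw [measureReal_def, Measure.bind_apply hs κ.measurable.aemeasurable]
  exact (integral_toReal (κ.measurable_coe hs).aemeasurable
    (ae_of_all _ fun a => measure_lt_top _ _)).symm

/-- Data processing inequality for the hockey-stick divergence. -/
theorem hsDiv_bind_le {Ω Ω' : Type*} [MeasurableSpace Ω] [MeasurableSpace Ω'] {α : ℝ}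
    (hα : 0 ≤ α) (μ ν : Measure Ω) [IsFiniteMeasure μ] [IsFiniteMeasure ν]
    (κ : Kernel Ω Ω') [IsMarkovKernel κ] :
    hsDiv α (μ.bind κ) (ν.bind κ) ≤ hsDiv α μ ν := by
  refine hsDiv_le fun s hs => ?_
  rw [μ.measureReal_bind_kernel κ hs, ν.measureReal_bind_kernel κ hs]
  exact integral_sub_le_hsDiv hα μ ν (κ.measurable_coe hs).ennreal_toReal
    (fun _ => measureReal_nonneg) (fun _ => measureReal_le_one)

theorem hsDiv_bind_le_of_forall_le {Ω Ω' : Type*} [MeasurableSpace Ω] [MeasurableSpace Ω']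
    {α c : ℝ} (hα : 0 ≤ α) (μ : Measure Ω) [IsProbabilityMeasure μ]
    (κ η : Kernel Ω Ω') [IsMarkovKernel κ] [IsMarkovKernel η]
    (h : ∀ a, hsDiv α (κ a) (η a) ≤ c) :
    hsDiv α (μ.bind κ) (μ.bind η) ≤ c := by
  refine hsDiv_le fun s hs => ?_
  have hκ := κ.integrable_measureReal μ hs
  have hη := (η.integrable_measureReal μ hs).const_mul α
  rw [μ.measureReal_bind_kernel κ hs, μ.measureReal_bind_kernel η hs, ← integral_const_mul,
    ← integral_sub hκ hη]
  calc _ ≤ ∫ _, c ∂μ := integral_mono (hκ.sub hη) (integrable_const _) fun a =>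
        (measureReal_sub_le_hsDiv hα (κ a) (η a) hs).trans (h a)
    _ = c := by simp

theorem composedLaw_succ {A : Type*} [MeasurableSpace A] {K N' D : ℕ}
    (M : Fin K → Kernel ((Fin N' → A) × (Fin D → ℝ)) (Fin D → ℝ))
    (x : Fin (K * N') → A) (o0 : Fin D → ℝ) {k : ℕ} (h : k < K) :
    composedLaw M x o0 (k + 1) = (composedLaw M x o0 k).bind
      ((M ⟨k, h⟩).comap (Prod.mk (blockOf x ⟨k, h⟩)) measurable_prodMk_left) := by
  rw [composedLaw, dif_pos h]
  rfl

theorem isProbabilityMeasure_composedLaw {A : Type*} [MeasurableSpace A] {K N' D : ℕ}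
    (M : Fin K → Kernel ((Fin N' → A) × (Fin D → ℝ)) (Fin D → ℝ))
    (hM : ∀ k, IsMarkovKernel (M k)) (x : Fin (K * N') → A) (o0 : Fin D → ℝ) (k : ℕ) :
    IsProbabilityMeasure (composedLaw M x o0 k) := by
  induction k with
  | zero => rw [composedLaw]; infer_instance
  | succ k ih =>
    by_cases h : k < K
    · rw [composedLaw_succ M x o0 h]
      infer_instance
    · rwa [composedLaw, dif_neg h]

theorem composedLaw_congr {A : Type*} [MeasurableSpace A] {K N' D : ℕ}
    (M : Fin K → Kernel ((Fin N' → A) × (Fin D → ℝ)) (Fin D → ℝ))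
    {x x' : Fin (K * N') → A} (o0 : Fin D → ℝ) {k : ℕ}
    (h : ∀ i : Fin K, (i : ℕ) < k → blockOf x i = blockOf x' i) :
    composedLaw M x o0 k = composedLaw M x' o0 k := by
  induction k with
  | zero => rfl
  | succ k ih =>
    have hk := ih fun i hi => h i (by omega)
    by_cases hkK : k < K
    · rw [composedLaw_succ M x o0 hkK, composedLaw_succ M x' o0 hkK, hk,
        h ⟨k, hkK⟩ (Nat.lt_succ_self k)]
    · rw [composedLaw, composedLaw, dif_neg hkK, dif_neg hkK, hk]

/-- Datasets differing in exactly one index differ in exactly one block, and there in exactly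
one index. -/
theorem exists_block_differing {A : Type*} {K N' : ℕ} {x x' : Fin (K * N') → A}
    (hxx : ∃ n, x n ≠ x' n ∧ ∀ m, m ≠ n → x m = x' m) :
    ∃ j : Fin K, (∀ i, i ≠ j → blockOf x i = blockOf x' i) ∧
      ∃ n, blockOf x j n ≠ blockOf x' j n ∧
        ∀ m, m ≠ n → blockOf x j m = blockOf x' j m := by
  obtain ⟨n, hn, hne⟩ := hxx
  have hsplit : (n.divNat : ℕ) * N' + (n.modNat : ℕ) = n := by
    simpa [mul_comm] using Nat.div_add_mod (n : ℕ) N'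
  refine ⟨n.divNat, fun i hi => funext fun a => hne _ fun h => hi ?_, n.modNat, ?_,
    fun m hm => hne _ fun h => hm ?_⟩
  · have hN : 0 < N' := a.pos
    ext
    rw [Fin.coe_divNat, ← h]
    simp [mul_comm _ N', Nat.mul_add_div hN,
      Nat.div_eq_of_lt a.isLt]
  · simpa only [blockOf, hsplit] using hn
  · have := congrArg Fin.val h
    ext
    simp only at this
    omega

/-- After the only block on which two datasets differ, the divergence of the composed laws is
at most any uniform bound on the divergence of the component acting on that block. -/
theorem hsDiv_composedLaw_le {A : Type*} [MeasurableSpace A] {K N' D : ℕ}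
    (M : Fin K → Kernel ((Fin N' → A) × (Fin D → ℝ)) (Fin D → ℝ))
    (hM : ∀ k, IsMarkovKernel (M k)) {x x' : Fin (K * N') → A} (o0 : Fin D → ℝ)
    {α c : ℝ} (hα : 0 ≤ α) (j : Fin K) (hj : ∀ i, i ≠ j → blockOf x i = blockOf x' i)
    (hc : ∀ z, hsDiv α (M j (blockOf x j, z)) (M j (blockOf x' j, z)) ≤ c)
    {k : ℕ} (hk : (j : ℕ) + 1 ≤ k) :
    hsDiv α (composedLaw M x o0 k) (composedLaw M x' o0 k) ≤ c := by
  have hprob := isProbabilityMeasure_composedLaw M hM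
  induction k, hk using Nat.le_induction with
  | base =>
    rw [composedLaw_succ M x o0 j.isLt, composedLaw_succ M x' o0 j.isLt,
      composedLaw_congr M o0 fun i hi => hj i (Fin.ne_of_lt hi)]
    exact hsDiv_bind_le_of_forall_le hα _ _ _ hc
  | succ k hjk ih =>
    by_cases hkK : k < K
    · rw [composedLaw_succ M x o0 hkK, composedLaw_succ M x' o0 hkK,
        hj ⟨k, hkK⟩ (Fin.ne_of_gt hjk)]
      exact (hsDiv_bind_le hα _ _ _).trans ih
    · rwa [composedLaw, composedLaw, dif_neg hkK, dif_neg hkK]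

/-- adaptive parallel composition. If each component kernel
`M^{(k)}` is dominated (for every auxiliary input, every pair of inputs
differing in exactly one index, and every `α ≥ 0`) by a pair of probability
measures `(P^{(k)}, Q^{(k)})` on ℝ, then the adaptively composed mechanism,
whose components access disjoint blocks of the dataset, satisfies
`H_α(M_x‖M_{x'}) ≤ max_k H_α(P^{(k)}‖Q^{(k)})` for every pair of datasets
differing in exactly one index. -/
theorem stmt_6 {A : Type*} [MeasurableSpace A] (K N' D : ℕ)
    (hK : 1 ≤ K) (hN' : 1 ≤ N') (hD : 1 ≤ D)
    (M : Fin K → Kernel ((Fin N' → A) × (Fin D → ℝ)) (Fin D → ℝ))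
    (hM : ∀ k, IsMarkovKernel (M k))
    (P Q : Fin K → Measure ℝ)
    (hP : ∀ k, IsProbabilityMeasure (P k)) (hQ : ∀ k, IsProbabilityMeasure (Q k))
    (hdom : ∀ (k : Fin K) (z : Fin D → ℝ) (y y' : Fin N' → A),
      (∃ n, y n ≠ y' n ∧ ∀ m, m ≠ n → y m = y' m) →
      ∀ α : ℝ, 0 ≤ α →
        hsDiv α ((M k) (y, z)) ((M k) (y', z)) ≤ hsDiv α (P k) (Q k))
    (o0 : Fin D → ℝ) (x x' : Fin (K * N') → A)
    (hxx : ∃ n, x n ≠ x' n ∧ ∀ m, m ≠ n → x m = x' m)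
    (α : ℝ) (hα : 0 ≤ α) :
    hsDiv α (composedLaw M x o0 K) (composedLaw M x' o0 K) ≤
      ⨆ k : Fin K, hsDiv α (P k) (Q k) := by
  obtain ⟨j, hj, hdiff⟩ := exists_block_differing hxx
  exact (hsDiv_composedLaw_le M hM o0 hα j hj
    (fun z => hdom j z _ _ hdiff α hα) j.isLt).trans
    (le_ciSup (f := fun k => hsDiv α (P k) (Q k)) (Set.finite_range _).bddAbove j)

end
end

section
/- Let B̂ be a Markov kernel from (ℝ^L)^{N'} to ℝ^D that is invariant under permutations of its N' input sequences, and let M̃ map x ∈ (ℝ^L)^N to the law of the output of B̂ applied to the tuple of sequences (x_n)_{n ∈ S} (in increasing index order), where S is a uniformly random size-N' subset of {1,…,N}; set ρ = N'/N. Then for every α ≥ 0: the supremum over all 1-event neighboring pairs x ≃ x' of H_α(M̃_x ‖ M̃_{x'}) is at most (1−ρ)·max{0, 1−α} + ρ·(the supremum, over all y', y'' ∈ (ℝ^L)^{N'} that agree in all indices except one, in which their sequences differ in exactly one coordinate, of H_α(B̂_{y'} ‖ B̂_{y''})). -/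
open MeasureTheory ProbabilityTheory ENNReal

noncomputable section

/-- 1-event neighboring datasets: all sequences agree except one, which differs
in exactly one entry. -/
def Neighb1 {L N : ℕ} (x x' : Fin N → Fin L → ℝ) : Prop :=
  ∃ n, (∀ m, m ≠ n → x m = x' m) ∧
    ∃ i, x n i ≠ x' n i ∧ ∀ j, j ≠ i → x n j = x' n j

/-- Subsampled mechanism: apply the base kernel `B` to the tuple of sequences
indexed by a uniformly random size-`N'` subset of `{1,…,N}`, listed in
increasing index order. -/
def worMech {L D N N' : ℕ}
    (B : Kernel (Fin N' → Fin L → ℝ) (Fin D → ℝ))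
    (x : Fin N → Fin L → ℝ) : Measure (Fin D → ℝ) :=
  ((N.choose N' : ℝ≥0∞))⁻¹ •
    ∑ s : {s : Finset (Fin N) // s.card = N'},
      B (fun i : Fin N' => x ((s.1.orderIsoOfFin s.2 i) : Fin N))


lemma hsDiv_bddAbove {Ω : Type*} [MeasurableSpace Ω] {α : ℝ} (hα : 0 ≤ α)
    (P Q : Measure Ω) [IsProbabilityMeasure P] :
    BddAbove (Set.range fun A : {s : Set Ω // MeasurableSet s} =>
      (P A.1).toReal - α * (Q A.1).toReal) := by
  refine ⟨1, ?_⟩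
  rintro _ ⟨A, rfl⟩
  have h1 : (P A.1).toReal ≤ 1 := measureReal_le_one
  have h2 : 0 ≤ α * (Q A.1).toReal := mul_nonneg hα ENNReal.toReal_nonneg
  dsimp only
  linarith

lemma hsDiv_le_one {Ω : Type*} [MeasurableSpace Ω] {α : ℝ} (hα : 0 ≤ α)
    (P Q : Measure Ω) [IsProbabilityMeasure P] : hsDiv α P Q ≤ 1 := by
  refine Real.iSup_le (fun A => ?_) zero_le_one
  have h1 : (P A.1).toReal ≤ 1 := measureReal_le_one
  have h2 : 0 ≤ α * (Q A.1).toReal := mul_nonneg hα ENNReal.toReal_nonneg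
  linarith

lemma hsDiv_nonneg {Ω : Type*} [MeasurableSpace Ω] {α : ℝ} (hα : 0 ≤ α)
    (P Q : Measure Ω) [IsProbabilityMeasure P] : 0 ≤ hsDiv α P Q := by
  refine le_ciSup_of_le (hsDiv_bddAbove hα P Q) ⟨∅, MeasurableSet.empty⟩ ?_
  simp

/-- The number of size-`k` subsets of `Fin N` avoiding a given point. -/
lemma card_subsets_notMem {N : ℕ} (k : ℕ) (n : Fin N) :
    (Finset.univ.filter fun s : {s : Finset (Fin N) // s.card = k} => n ∉ s.1).card =
      (N - 1).choose k := by
  rw [← Finset.card_map (Function.Embedding.subtype _)]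
  have h : (Finset.univ.filter fun s : {s : Finset (Fin N) // s.card = k} => n ∉ s.1).map
      (Function.Embedding.subtype _) = Finset.powersetCard k (Finset.univ.erase n) := by
    ext s
    simp only [Finset.mem_map, Finset.mem_filter, Finset.mem_univ, true_and,
      Function.Embedding.coe_subtype, Subtype.exists, exists_and_left, exists_prop,
      Finset.mem_powersetCard]
    simp [Finset.subset_erase, and_comm]
  rw [h, Finset.card_powersetCard, Finset.card_erase_of_mem (Finset.mem_univ n)]
  simp

/-- Averaging over the size-`k` subsets of `Fin N` a quantity that depends only on whether the
subset contains `n`. -/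
lemma sum_subsets_ite {N k : ℕ} (hk : 1 ≤ k) (hkN : k ≤ N) (n : Fin N) (a b : ℝ) :
    ((N.choose k : ℝ))⁻¹ *
        ∑ s : {s : Finset (Fin N) // s.card = k}, (if n ∈ s.1 then a else b) =
      (1 - (k : ℝ) / N) * b + (k : ℝ) / N * a := by
  have hcard : (Finset.univ.filter
        fun s : {s : Finset (Fin N) // s.card = k} => n ∈ s.1).card +
      (N - 1).choose k = N.choose k := by
    rw [← card_subsets_notMem k n, Finset.card_filter_add_card_filter_not]
    simp
  obtain ⟨k, rfl⟩ : ∃ j, k = j + 1 := ⟨k - 1, by omega⟩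
  obtain ⟨N, rfl⟩ : ∃ j, N = j + 1 := ⟨N - 1, by omega⟩
  have hpos : (0 : ℝ) < ((N + 1).choose (k + 1) : ℕ) := by
    exact_mod_cast Nat.choose_pos hkN
  have hmul : ((N : ℝ) + 1) * (N.choose k : ℕ) = ((N + 1).choose (k + 1) : ℕ) * ((k : ℝ) + 1) := by
    exact_mod_cast Nat.add_one_mul_choose_eq N k
  have hpascal : (((N + 1).choose (k + 1) : ℕ) : ℝ) = N.choose k + N.choose (k + 1) := by
    exact_mod_cast Nat.choose_succ_succ N k
  have hmem : (Finset.univ.filter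
      fun s : {s : Finset (Fin (N + 1)) // s.card = k + 1} => n ∈ s.1).card = N.choose k := by
    have := Nat.choose_succ_succ N k
    simp only [Nat.add_sub_cancel, Nat.succ_eq_add_one] at hcard this
    omega
  rw [Finset.sum_ite, Finset.sum_const, Finset.sum_const, hmem, card_subsets_notMem]
  simp only [nsmul_eq_mul, Nat.add_sub_cancel, Nat.cast_add, Nat.cast_one]
  have hN : (0 : ℝ) < N + 1 := by positivity
  field_simp
  linear_combination (a - b) * hmul - (N + 1 : ℝ) * b * hpascal

lemma worMech_apply_toReal {L D N N' : ℕ} (B : Kernel (Fin N' → Fin L → ℝ) (Fin D → ℝ))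
    [IsMarkovKernel B] (x : Fin N → Fin L → ℝ) (A : Set (Fin D → ℝ)) :
    (worMech B x A).toReal = ((N.choose N' : ℝ))⁻¹ *
      ∑ s : {s : Finset (Fin N) // s.card = N'},
        (B (fun i : Fin N' => x ((s.1.orderIsoOfFin s.2 i) : Fin N)) A).toReal := by
  rw [worMech, Measure.smul_apply, Measure.finsetSum_apply, smul_eq_mul, ENNReal.toReal_mul,
    ENNReal.toReal_sum fun s _ => measure_ne_top _ _]
  simp

/-- Restricting neighboring datasets to a subset containing the differing index yields
neighboring batches. -/
lemma Neighb1.comp_orderIso {L N N' : ℕ} {x x' : Fin N → Fin L → ℝ} {n : Fin N}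
    (hne : ∀ m, m ≠ n → x m = x' m)
    (hent : ∃ i, x n i ≠ x' n i ∧ ∀ j, j ≠ i → x n j = x' n j)
    {s : Finset (Fin N)} (hs : s.card = N') (hn : n ∈ s) :
    Neighb1 (fun i : Fin N' => x ((s.orderIsoOfFin hs i) : Fin N))
      (fun i : Fin N' => x' ((s.orderIsoOfFin hs i) : Fin N)) := by
  refine ⟨(s.orderIsoOfFin hs).symm ⟨n, hn⟩, fun m hm => hne _ fun h => hm ?_, ?_⟩
  · rw [OrderIso.eq_symm_apply]
    exact Subtype.ext h
  · simpa only [OrderIso.apply_symm_apply] using hent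

/-- joint-convexity bound. For a permutation-invariant Markov
base kernel `B̂` and the subsampled mechanism `M̃` with `ρ = N'/N`, the
supremum over 1-event neighboring datasets of `H_α(M̃_x‖M̃_{x'})` is at most
`(1−ρ)·max{0,1−α} + ρ·sup H_α(B̂_{y'}‖B̂_{y''})`, the inner supremum ranging
over batches `y', y''` agreeing in all indices except one, at which their
sequences differ in exactly one coordinate. -/
theorem stmt_14 (L D N N' : ℕ)
    (hL : 1 ≤ L) (hD : 1 ≤ D) (hN' : 1 ≤ N') (hN : N' ≤ N)
    (B : Kernel (Fin N' → Fin L → ℝ) (Fin D → ℝ)) [IsMarkovKernel B]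
    (hperm : ∀ (e : Equiv.Perm (Fin N')) (y : Fin N' → Fin L → ℝ),
      B (fun i => y (e i)) = B y)
    (α : ℝ) (hα : 0 ≤ α) :
    (⨆ p : {p : (Fin N → Fin L → ℝ) × (Fin N → Fin L → ℝ) // Neighb1 p.1 p.2},
      hsDiv α (worMech B p.1.1) (worMech B p.1.2)) ≤
    (1 - (N' : ℝ) / (N : ℝ)) * max 0 (1 - α) +
    ((N' : ℝ) / (N : ℝ)) *
      ⨆ q : {q : (Fin N' → Fin L → ℝ) × (Fin N' → Fin L → ℝ) // Neighb1 q.1 q.2},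
        hsDiv α (B q.1.1) (B q.1.2) := by
  set H := ⨆ q : {q : (Fin N' → Fin L → ℝ) × (Fin N' → Fin L → ℝ) // Neighb1 q.1 q.2},
    hsDiv α (B q.1.1) (B q.1.2)
  have hH0 : 0 ≤ H := Real.iSup_nonneg fun q => hsDiv_nonneg hα _ _
  have hbdd : BddAbove (Set.range fun q : {q : (Fin N' → Fin L → ℝ) × (Fin N' → Fin L → ℝ) //
      Neighb1 q.1 q.2} => hsDiv α (B q.1.1) (B q.1.2)) := by
    refine ⟨1, ?_⟩
    rintro _ ⟨q, rfl⟩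
    exact hsDiv_le_one hα _ _
  have hρ : (N' : ℝ) / N ≤ 1 := div_le_one_of_le₀ (by exact_mod_cast hN) (by positivity)
  have hrhs : 0 ≤ (1 - (N' : ℝ) / N) * max 0 (1 - α) + (N' : ℝ) / N * H :=
    add_nonneg (mul_nonneg (sub_nonneg.2 hρ) (le_max_left _ _)) (by positivity)
  refine Real.iSup_le ?_ hrhs
  rintro ⟨⟨x, x'⟩, n, hne, hent⟩
  refine Real.iSup_le ?_ hrhs
  rintro ⟨A, hA⟩
  dsimp only
  rw [worMech_apply_toReal, worMech_apply_toReal, mul_left_comm, ← mul_sub, Finset.mul_sum,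
    ← Finset.sum_sub_distrib, ← sum_subsets_ite hN' hN n]
  refine mul_le_mul_of_nonneg_left (Finset.sum_le_sum fun s _ => ?_) (by positivity)
  split_ifs with hn
  · have hnb := Neighb1.comp_orderIso hne hent s.2 hn
    exact (le_ciSup (hsDiv_bddAbove hα (B _) (B _)) ⟨A, hA⟩).trans
      (le_ciSup hbdd ⟨(_, _), hnb⟩)
  · have heq : (fun i : Fin N' => x ((s.1.orderIsoOfFin s.2 i) : Fin N)) =
        fun i : Fin N' => x' ((s.1.orderIsoOfFin s.2 i) : Fin N) := by
      funext i
      exact hne _ fun h => hn (h ▸ (s.1.orderIsoOfFin s.2 i).2)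
    rw [heq]
    set t := (B (fun i : Fin N' => x' ((s.1.orderIsoOfFin s.2 i) : Fin N)) A).toReal
    have ht0 : 0 ≤ t := ENNReal.toReal_nonneg
    have ht1 : t ≤ 1 := measureReal_le_one
    calc t - α * t = t * (1 - α) := by ring
      _ ≤ t * max 0 (1 - α) := mul_le_mul_of_nonneg_left (le_max_right _ _) ht0
      _ ≤ max 0 (1 - α) := mul_le_of_le_one_left (le_max_left _ _) ht1

end
end
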